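/- Let f be a C^3 multicritical circle map with N critical points and irrational rotation number α = [a_1, a_2, …], and consider the dynamical partitions P_n associated to a critical point c of f. Suppose M > 1 and n ≥ 1 are such that for all 0 ≤ i < q_n, all 0 ≤ s < r_n and all k_s^{(n)} < j < k_{s+1}^{(n)} one has M^{−1}·|I_{n−1}^i|/min{j − k_s^{(n)}, k_{s+1}^{(n)} − j}^2 < |Δ^{(n)}_{i,j}| < M·|I_{n−1}^i|/min{j − k_s^{(n)}, k_{s+1}^{(n)} − j}^2, where |·| denotes Lebesgue measure. Then for every 0 < γ < 1, one has |A^n_γ| ≤ (4N + 2)·M/⌊a_{n+1}^γ⌋. -/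

import Mathlib

open MeasureTheory Set Filter
open scoped ENNReal NNReal

noncomputable section

/-- The circle `S¹ = ℝ/ℤ`. -/
abbrev Circle1 := AddCircle (1 : ℝ)

/-- Projection `ℝ → S¹`. -/
def projC (x : ℝ) : Circle1 := (x : Circle1)

/-- An orientation-preserving circle homeomorphism, given together with a
(strictly monotone, continuous) lift `F : ℝ → ℝ` satisfying `F (x+1) = F x + 1`. -/
structure CircleHomeo where
  toHomeo : Circle1 ≃ₜ Circle1
  lift : ℝ → ℝ
  lift_strictMono : StrictMono lift
  lift_continuous : Continuous lift
  lift_add_one : ∀ x : ℝ, lift (x + 1) = lift x + 1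
  lift_proj : ∀ x : ℝ, toHomeo (projC x) = projC (lift x)

/-- The underlying map `S¹ → S¹`. -/
def CircleHomeo.toFun (H : CircleHomeo) : Circle1 → Circle1 := H.toHomeo

/-- `α ∈ [0,1)` is the rotation number of `H`: `α = lim Fⁿ(x)/n (mod 1)`. -/
def HasRotationNumber (H : CircleHomeo) (α : ℝ) : Prop :=
  α ∈ Set.Ico (0 : ℝ) 1 ∧ ∃ β : ℝ, Int.fract β = α ∧
    ∀ x : ℝ, Filter.Tendsto (fun n : ℕ => H.lift^[n] x / n) Filter.atTop (nhds β)

/-- `μ` is an invariant Borel probability measure for `H`. -/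
def IsInvProbMeasure (H : CircleHomeo) (μ : Measure Circle1) : Prop :=
  IsProbabilityMeasure μ ∧ μ.map H.toFun = μ

/-- Hausdorff dimension of a measure: `inf {dim_H X : μ X = 1}`. -/
def dimHMeasure (μ : Measure Circle1) : ℝ≥0∞ :=
  ⨅ (X : Set Circle1) (_ : MeasurableSet X) (_ : μ X = 1), dimH X

/-- The set `D(γ,τ)` of Diophantine numbers of type `(γ,τ)`. -/
def DiophClass (γ τ : ℝ) : Set ℝ :=
  {α : ℝ | ∀ p q : ℤ, q ≠ 0 → γ / |(q : ℝ)| ^ (τ + 2) ≤ |α - (p : ℝ) / (q : ℝ)|}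

/-- The set `D_τ = ⋃_{γ > 0} D(γ,τ)`. -/
def DiophTau (τ : ℝ) : Set ℝ := {α : ℝ | ∃ γ > 0, α ∈ DiophClass γ τ}

/-- Iterates of the Gauss map, starting from `α`. -/
def gaussIter (α : ℝ) : ℕ → ℝ
  | 0 => α
  | n + 1 => Int.fract (1 / gaussIter α n)

/-- The `n`-th partial quotient `a_n` (`n ≥ 1`) of the continued fraction of `α`. -/
def cfA (α : ℝ) (n : ℕ) : ℕ := ⌊1 / gaussIter α (n - 1)⌋₊

/-- Denominators of the convergents: `q_0 = 1`, `q_1 = a_1`, `q_n = a_n q_{n-1} + q_{n-2}`. -/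
def cfQ (α : ℝ) : ℕ → ℕ
  | 0 => 1
  | 1 => cfA α 1
  | n + 2 => cfA α (n + 2) * cfQ α (n + 1) + cfQ α n

/-- Positive displacement from `a` to `z` on the circle, a number in `[0,1)`. -/
def circDisp (a z : Circle1) : ℝ := (AddCircle.equivIco 1 0 (z - a)).1

/-- The circle arc `[a, b)`. -/
def arcIco (a b : Circle1) : Set Circle1 := {z : Circle1 | circDisp a z < circDisp a b}

namespace DynPart

/-- `x_i = f^i(x_0)`. -/
def pt (H : CircleHomeo) (x0 : Circle1) (i : ℕ) : Circle1 := H.toFun^[i] x0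

/-- The interval `I_n`: `[x_0, x_{q_n})` for even `n`, `[x_{q_n}, x_0)` for odd `n`. -/
def In (H : CircleHomeo) (α : ℝ) (x0 : Circle1) (n : ℕ) : Set Circle1 :=
  if Even n then arcIco x0 (pt H x0 (cfQ α n)) else arcIco (pt H x0 (cfQ α n)) x0

/-- `I_n^i = f^i(I_n)`. -/
def Ini (H : CircleHomeo) (α : ℝ) (x0 : Circle1) (n i : ℕ) : Set Circle1 :=
  H.toFun^[i] '' In H α x0 n

/-- The dynamical partition `P_n(x_0)`. -/
def part (H : CircleHomeo) (α : ℝ) (x0 : Circle1) (n : ℕ) : Set (Set Circle1) :=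
  {S | ∃ i < cfQ α n, S = Ini H α x0 (n - 1) i} ∪
  {S | ∃ i < cfQ α (n - 1), S = Ini H α x0 n i}

/-- `Δ^{(n)}_{i,j} = I_n^{i + q_{n-1} + j q_n}`. -/
def Δ (H : CircleHomeo) (α : ℝ) (x0 : Circle1) (n i j : ℕ) : Set Circle1 :=
  Ini H α x0 n (i + cfQ α (n - 1) + j * cfQ α n)

end DynPart

/-- `φ` is a `C³` diffeomorphism from the open set `U` onto the open set `V`. -/
def IsC3DiffeoOn (φ : ℝ → ℝ) (U V : Set ℝ) : Prop :=
  IsOpen U ∧ IsOpen V ∧ ContDiffOn ℝ 3 φ U ∧ Set.BijOn φ U V ∧ ∀ x ∈ U, deriv φ x ≠ 0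

/-- `c` is a critical point of power-law type with exponent `p`: in suitable `C³`
coordinates around `c` and `H c`, the map takes the form `x ↦ x |x|^{p-1}`. -/
def IsPowerLawCritPt (H : CircleHomeo) (c p : ℝ) : Prop :=
  ∃ (U V U' V' : Set ℝ) (φ ψ : ℝ → ℝ),
    c ∈ U ∧ H.lift c ∈ U' ∧ (0 : ℝ) ∈ V ∧ (0 : ℝ) ∈ V' ∧
    IsC3DiffeoOn φ U V ∧ IsC3DiffeoOn ψ U' V' ∧
    φ c = 0 ∧ ψ (H.lift c) = 0 ∧ Set.MapsTo H.lift U U' ∧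
    ∀ x ∈ U, ψ (H.lift x) = φ x * |φ x| ^ (p - 1)

/-- A `C³` multicritical circle map: an orientation-preserving `C³` circle
homeomorphism whose critical points are exactly `c_0, …, c_{N-1}` (represented in
`[0,1)`), each of power-law type with criticality `p_i > 1`. -/
structure MulticriticalCircleMap extends CircleHomeo where
  smooth : ContDiff ℝ 3 lift
  N : ℕ
  N_pos : 0 < N
  crit : Fin N → ℝ
  crit_mem : ∀ i, crit i ∈ Set.Ico (0 : ℝ) 1
  crit_inj : Function.Injective crit
  critExp : Fin N → ℝ
  critExp_gt_one : ∀ i, 1 < critExp i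
  crit_powerLaw : ∀ i, IsPowerLawCritPt toCircleHomeo (crit i) (critExp i)
  crit_complete : ∀ x : ℝ, deriv lift x = 0 → ∃ (i : Fin N) (k : ℤ), x = crit i + (k : ℝ)

/-- `z ∈ S¹` is a critical point of `f^m`. -/
def IsCritPtOfIter (f : MulticriticalCircleMap) (m : ℕ) (z : Circle1) : Prop :=
  ∃ x : ℝ, projC x = z ∧ deriv (f.lift^[m]) x = 0

/-- Indices `0 < j < a_{n+1} - 1` such that the closure of `Δ_j^{(n)}` contains a
critical point of `T_n = f^{q_n}`. -/
def critTimesSet (f : MulticriticalCircleMap) (α : ℝ) (x0 : Circle1) (n : ℕ) : Finset ℕ :=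
  @Finset.filter ℕ
    (fun j => ∃ z ∈ closure (DynPart.Δ f.toCircleHomeo α x0 n 0 j),
      IsCritPtOfIter f (cfQ α n) z)
    (Classical.decPred _)
    (Finset.Ioo 0 (cfA α (n + 1) - 1))

/-- The number `r_n` of bridges (`r_n = #{interior critical times} + 1`). -/
def rn (f : MulticriticalCircleMap) (α : ℝ) (x0 : Circle1) (n : ℕ) : ℕ :=
  (critTimesSet f α x0 n).card + 1

/-- The critical times `0 = k_0^{(n)} < k_1^{(n)} < … < k_{r_n}^{(n)} = a_{n+1} - 1`. -/
def kTime (f : MulticriticalCircleMap) (α : ℝ) (x0 : Circle1) (n : ℕ) (s : ℕ) : ℕ :=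
  (((0 : ℕ) :: (critTimesSet f α x0 n).sort (· ≤ ·)) ++ [cfA α (n + 1) - 1]).getD s
    (cfA α (n + 1) - 1)

/-- The `s`-th bridge `G_s^{(n)} = ⋃_{k_s < j < k_{s+1}} Δ_j^{(n)}`. -/
def bridge (f : MulticriticalCircleMap) (α : ℝ) (x0 : Circle1) (n s : ℕ) : Set Circle1 :=
  ⋃ j ∈ Set.Ioo (kTime f α x0 n s) (kTime f α x0 n (s + 1)),
    DynPart.Δ f.toCircleHomeo α x0 n 0 j

/-- The trimmed bridge `G_{s,γ}^{(n)}`. -/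
def bridgeGamma (f : MulticriticalCircleMap) (α : ℝ) (x0 : Circle1) (n : ℕ) (γ : ℝ)
    (s : ℕ) : Set Circle1 :=
  ⋃ j ∈ {j : ℕ | (kTime f α x0 n s : ℝ) + (cfA α (n + 1) : ℝ) ^ γ < (j : ℝ) ∧
      (j : ℝ) < (kTime f α x0 n (s + 1) : ℝ) + 1 - (cfA α (n + 1) : ℝ) ^ γ},
    DynPart.Δ f.toCircleHomeo α x0 n 0 j

/-- `A^n_{i,γ} = ⋃_{s < r_n} f^i(G_{s,γ}^{(n)})`. -/
def Aset (f : MulticriticalCircleMap) (α : ℝ) (x0 : Circle1) (n i : ℕ) (γ : ℝ) :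
    Set Circle1 :=
  ⋃ s ∈ Set.Iio (rn f α x0 n), f.toCircleHomeo.toFun^[i] '' bridgeGamma f α x0 n γ s

/-- `A^n_γ = ⋃_{i < q_n} A^n_{i,γ}`. -/
def AsetAll (f : MulticriticalCircleMap) (α : ℝ) (x0 : Circle1) (n : ℕ) (γ : ℝ) :
    Set Circle1 :=
  ⋃ i ∈ Set.Iio (cfQ α n), Aset f α x0 n i γ

/-- The Schwarzian derivative `Sf = f'''/f' - (3/2)(f''/f')²`. -/
def schwarzianAt (f : ℝ → ℝ) (x : ℝ) : ℝ :=
  iteratedDeriv 3 f x / deriv f x - 3 / 2 * (iteratedDeriv 2 f x / deriv f x) ^ 2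

end

section ContinuedFraction

variable {α : ℝ}

lemma irrational_gaussIter (hα : Irrational α) (n : ℕ) : Irrational (gaussIter α n) := by
  induction n with
  | zero => exact hα
  | succ n ih =>
    have h : Irrational (1 / gaussIter α n) := by simpa using ih.inv
    exact h.sub_intCast _

lemma gaussIter_mem_Ioo (hα : Irrational α) (h01 : α ∈ Ico (0 : ℝ) 1) (n : ℕ) :
    gaussIter α n ∈ Ioo (0 : ℝ) 1 := by
  have hne := (irrational_gaussIter hα n).ne_zero
  cases n with
  | zero => exact ⟨lt_of_le_of_ne h01.1 hne.symm, h01.2⟩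
  | succ n => exact ⟨lt_of_le_of_ne (Int.fract_nonneg _) hne.symm, Int.fract_lt_one _⟩

lemma cfA_succ_eq_sub (hα : Irrational α) (h01 : α ∈ Ico (0 : ℝ) 1) (n : ℕ) :
    (cfA α (n + 1) : ℝ) = 1 / gaussIter α n - gaussIter α (n + 1) := by
  have h := gaussIter_mem_Ioo hα h01 n
  have h0 : 0 ≤ 1 / gaussIter α n := by have := h.1; positivity
  have : (cfA α (n + 1) : ℝ) = (⌊1 / gaussIter α n⌋ : ℝ) := by
    simp only [cfA, Nat.add_sub_cancel]
    exact natCast_floor_eq_intCast_floor h0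
  rw [this, gaussIter, Int.fract]
  ring

lemma one_le_cfA_succ (hα : Irrational α) (h01 : α ∈ Ico (0 : ℝ) 1) (n : ℕ) :
    1 ≤ cfA α (n + 1) := by
  have h := gaussIter_mem_Ioo hα h01 n
  exact Nat.one_le_floor_iff _ |>.2 (one_le_one_div h.1 h.2.le)

/-- Numerators of the convergents of the continued fraction of `α`. -/
noncomputable def cfP (α : ℝ) : ℕ → ℕ
  | 0 => 0
  | 1 => 1
  | n + 2 => cfA α (n + 2) * cfP α (n + 1) + cfP α n

/-- The signed approximation error `q_n α - p_n` of the `n`-th convergent. -/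
noncomputable def cfErr (α : ℝ) (n : ℕ) : ℝ := cfQ α n * α - cfP α n

lemma cfQ_add_two (α : ℝ) (n : ℕ) :
    cfQ α (n + 2) = cfA α (n + 2) * cfQ α (n + 1) + cfQ α n := rfl

lemma cfQ_pos (hα : Irrational α) (h01 : α ∈ Ico (0 : ℝ) 1) (n : ℕ) : 0 < cfQ α n := by
  induction n using Nat.twoStepInduction with
  | zero => exact Nat.one_pos
  | one => exact one_le_cfA_succ hα h01 0
  | more n ih _ => rw [cfQ_add_two]; positivity

lemma cfErr_succ (hα : Irrational α) (h01 : α ∈ Ico (0 : ℝ) 1) (n : ℕ) :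
    cfErr α (n + 1) = -gaussIter α (n + 1) * cfErr α n := by
  induction n with
  | zero =>
    have hne : α ≠ 0 := hα.ne_zero
    have h := cfA_succ_eq_sub hα h01 0
    simp only [zero_add] at h
    simp only [cfErr, cfQ, cfP, h, gaussIter]
    push_cast
    field_simp
    ring
  | succ n ih =>
    have hne := (irrational_gaussIter hα (n + 1)).ne_zero
    have h := cfA_succ_eq_sub hα h01 (n + 1)
    have hrec : cfErr α (n + 2) = cfA α (n + 2) * cfErr α (n + 1) + cfErr α n := by
      simp only [cfErr, cfQ, cfP]; push_cast; ring
    rw [hrec, h, ih]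
    field_simp
    ring

lemma neg_one_pow_mul_cfErr_pos (hα : Irrational α) (h01 : α ∈ Ico (0 : ℝ) 1) (n : ℕ) :
    0 < (-1) ^ n * cfErr α n := by
  induction n with
  | zero => simpa [cfErr, cfQ, cfP, gaussIter] using (gaussIter_mem_Ioo hα h01 0).1
  | succ n ih =>
    rw [cfErr_succ hα h01, pow_succ]
    have := mul_pos (gaussIter_mem_Ioo hα h01 (n + 1)).1 ih
    linarith

lemma abs_cfErr (hα : Irrational α) (h01 : α ∈ Ico (0 : ℝ) 1) (n : ℕ) :
    |cfErr α n| = (-1) ^ n * cfErr α n := by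
  rw [← abs_of_pos (neg_one_pow_mul_cfErr_pos hα h01 n), abs_mul]
  simp

lemma abs_cfErr_lt_one (hα : Irrational α) (h01 : α ∈ Ico (0 : ℝ) 1) (n : ℕ) :
    |cfErr α n| < 1 := by
  induction n with
  | zero =>
    have h := gaussIter_mem_Ioo hα h01 0
    simpa [cfErr, cfQ, cfP, abs_lt] using ⟨by linarith [h.1, show gaussIter α 0 = α from rfl], h.2⟩
  | succ n ih =>
    have h := gaussIter_mem_Ioo hα h01 (n + 1)
    rw [cfErr_succ hα h01, abs_mul, abs_neg, abs_of_pos h.1]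
    exact mul_lt_one_of_nonneg_of_lt_one_left h.1.le h.2 ih.le

lemma cfP_mul_cfQ_sub (α : ℝ) (n : ℕ) :
    (cfP α (n + 1) * cfQ α n - cfP α n * cfQ α (n + 1) : ℤ) = (-1) ^ n := by
  induction n with
  | zero => simp [cfP, cfQ]
  | succ n ih =>
    rw [pow_succ, ← ih]
    simp only [cfP, cfQ]
    push_cast
    ring

/-- The best approximation property of the convergents. -/
lemma abs_cfErr_le (hα : Irrational α) (h01 : α ∈ Ico (0 : ℝ) 1) (n : ℕ) {m : ℕ} (hm : 0 < m)
    (hmq : m < cfQ α (n + 1)) (k : ℤ) : |cfErr α n| ≤ |m * α - k| := by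
  have hdet := cfP_mul_cfQ_sub α n
  have hsq : ((-1) ^ n * (-1) ^ n : ℤ) = 1 := by rw [← mul_pow]; norm_num
  obtain ⟨u, hu⟩ : ∃ u : ℤ, u = (-1) ^ n * (m * cfP α (n + 1) - k * cfQ α (n + 1)) := ⟨_, rfl⟩
  obtain ⟨v, hv⟩ : ∃ v : ℤ, v = (-1) ^ n * (k * cfQ α n - m * cfP α n) := ⟨_, rfl⟩
  have hmuv : (m : ℤ) = u * cfQ α n + v * cfQ α (n + 1) := by
    rw [hu, hv]; linear_combination (-m * (-1) ^ n) * hdet - m * hsq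
  have hkuv : k = u * cfP α n + v * cfP α (n + 1) := by
    rw [hu, hv]; linear_combination (-k * (-1) ^ n) * hdet - k * hsq
  have hq0 : (0 : ℤ) < cfQ α n := mod_cast cfQ_pos hα h01 n
  have hq1 : (0 : ℤ) < cfQ α (n + 1) := mod_cast cfQ_pos hα h01 (n + 1)
  have hm0 : (0 : ℤ) < m := mod_cast hm
  have hm1 : (m : ℤ) < cfQ α (n + 1) := mod_cast hmq
  have hu0 : u ≠ 0 := by
    rintro rfl
    rcases le_or_gt v 0 with h | h <;> nlinarith
  have huv : u * v ≤ 0 := by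
    rcases lt_or_gt_of_ne hu0 with h | h
    · have : 0 < v := by by_contra! h'; nlinarith
      nlinarith
    · have : v ≤ 0 := by by_contra! h'; nlinarith
      nlinarith
  have heq : m * α - k = u * cfErr α n + v * cfErr α (n + 1) := by
    have h1 : (m : ℝ) = u * cfQ α n + v * cfQ α (n + 1) := mod_cast hmuv
    have h2 : (k : ℝ) = u * cfP α n + v * cfP α (n + 1) := mod_cast hkuv
    rw [h1, h2, cfErr, cfErr]; ring
  have hsucc := cfErr_succ hα h01 n
  have hg := (gaussIter_mem_Ioo hα h01 (n + 1)).1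
  have hu1 : (1 : ℝ) ≤ |(u : ℝ)| := mod_cast Int.one_le_abs hu0
  have huvR : (u : ℝ) * v ≤ 0 := mod_cast huv
  have habs : |(u : ℝ)| ≤ |u - v * gaussIter α (n + 1)| := by
    apply sq_le_sq.1
    nlinarith [mul_nonneg (neg_nonneg.2 huvR) hg.le, sq_nonneg (v * gaussIter α (n + 1))]
  rw [heq, hsucc,
    show (u : ℝ) * cfErr α n + v * (-gaussIter α (n + 1) * cfErr α n)
      = (u - v * gaussIter α (n + 1)) * cfErr α n by ring, abs_mul]
  exact le_mul_of_one_le_left (abs_nonneg _) (hu1.trans habs)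

end ContinuedFraction

section Arcs

lemma circDisp_projC (a z : ℝ) : circDisp (projC a) (projC z) = Int.fract (z - a) := by
  have h : projC z - projC a = ((z - a : ℝ) : Circle1) := rfl
  rw [circDisp, h, AddCircle.coe_equivIco_mk_apply]
  simp

lemma projC_eq_iff {y z : ℝ} : projC y = projC z ↔ ∃ k : ℤ, y = z + k := by
  simp only [projC, QuotientAddGroup.eq,
    AddSubgroup.mem_zmultiples_iff]
  constructor
  · rintro ⟨k, hk⟩
    refine ⟨-k, ?_⟩
    simp only [zsmul_eq_mul, mul_one] at hk
    push_cast
    linarith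
  · rintro ⟨k, rfl⟩
    exact ⟨-k, by simp⟩

lemma projC_add_intCast (y : ℝ) (k : ℤ) : projC (y + k) = projC y :=
  projC_eq_iff.2 ⟨k, rfl⟩

lemma arcIco_projC {a b : ℝ} (hab : a ≤ b) (hba : b < a + 1) :
    arcIco (projC a) (projC b) = projC '' Ico a b := by
  have hfr : Int.fract (b - a) = b - a := Int.fract_eq_self.2 ⟨by linarith, by linarith⟩
  ext z
  constructor
  · obtain ⟨y, rfl⟩ : ∃ y : ℝ, projC y = z := QuotientAddGroup.mk_surjective z
    intro hz
    rw [arcIco, mem_ofPred_eq, circDisp_projC, circDisp_projC, hfr] at hz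
    refine ⟨a + Int.fract (y - a), ⟨?_, ?_⟩, projC_eq_iff.2 ⟨-⌊y - a⌋, ?_⟩⟩
    · linarith [Int.fract_nonneg (y - a)]
    · linarith
    · rw [Int.fract]; push_cast; ring
  · rintro ⟨y, ⟨h1, h2⟩, rfl⟩
    rw [arcIco, mem_ofPred_eq, circDisp_projC, circDisp_projC, hfr,
      Int.fract_eq_self.2 ⟨by linarith, by linarith⟩]
    linarith

lemma measurableSet_arcIco (a b : Circle1) : MeasurableSet (arcIco a b) := by
  have h : Measurable (circDisp a) :=
    measurable_subtype_coe.comp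
      ((AddCircle.measurableEquivIco (1 : ℝ) 0).measurable.comp (measurable_id.sub_const a))
  exact measurableSet_lt h measurable_const

lemma closure_projC_image_Ico_subset (a b : ℝ) :
    closure (projC '' Ico a b) ⊆ projC '' Icc a b :=
  closure_minimal (image_mono Ico_subset_Icc_self)
    (isCompact_Icc.image (AddCircle.continuous_mk' (1 : ℝ))).isClosed

end Arcs

namespace CircleHomeo

variable (H : CircleHomeo)

/-- The lift of `H` as a degree one lift. -/
def deg1Lift : CircleDeg1Lift := ⟨⟨H.lift, H.lift_strictMono.monotone⟩, H.lift_add_one⟩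

lemma deg1Lift_pow_apply (m : ℕ) (x : ℝ) : (H.deg1Lift ^ m) x = H.lift^[m] x := by
  rw [CircleDeg1Lift.coe_pow]; rfl

lemma toFun_iterate_projC (m : ℕ) (x : ℝ) :
    H.toFun^[m] (projC x) = projC (H.lift^[m] x) :=
  (Function.Semiconj.iterate_right (f := projC) (ga := H.lift) (gb := H.toFun)
    (fun x => (H.lift_proj x).symm) m x).symm

lemma lift_iterate_add_intCast (m : ℕ) (x : ℝ) (k : ℤ) :
    H.lift^[m] (x + k) = H.lift^[m] x + k := by
  simp only [← deg1Lift_pow_apply, CircleDeg1Lift.map_add_int]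

lemma lift_iterate_image_Ico (m : ℕ) {a b : ℝ} (hab : a ≤ b) :
    H.lift^[m] '' Ico a b = Ico (H.lift^[m] a) (H.lift^[m] b) := by
  apply Subset.antisymm
  · rintro _ ⟨y, hy, rfl⟩
    exact ⟨(H.lift_strictMono.iterate m).monotone hy.1, H.lift_strictMono.iterate m hy.2⟩
  · exact intermediate_value_Ico hab (H.lift_continuous.iterate m).continuousOn

lemma toFun_iterate_image_projC_Ico (m : ℕ) {a b : ℝ} (hab : a ≤ b) :
    H.toFun^[m] '' (projC '' Ico a b) = projC '' Ico (H.lift^[m] a) (H.lift^[m] b) := by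
  rw [← H.lift_iterate_image_Ico m hab, image_image, image_image]
  simp only [toFun_iterate_projC]

variable {H} {β : ℝ}

lemma translationNumber_deg1Lift
    (h : ∀ x : ℝ, Tendsto (fun n : ℕ => H.lift^[n] x / n) atTop (nhds β)) :
    H.deg1Lift.translationNumber = β :=
  H.deg1Lift.translationNumber_eq_of_tendsto₀ (h 0)

/-- Translates of orbit points of the lift are ordered as for the rotation by `β`. -/
lemma lift_iterate_lt (hτ : H.deg1Lift.translationNumber = β) (x : ℝ) {a b : ℕ} {k l : ℤ}
    (h : a * β + k < b * β + l) : H.lift^[a] x + k < H.lift^[b] x + l := by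
  rcases le_total a b with hab | hab
  · obtain ⟨d, rfl⟩ := Nat.exists_eq_add_of_le' hab
    have hd : ((k - l : ℤ) : ℝ) < (H.deg1Lift ^ d).translationNumber := by
      rw [CircleDeg1Lift.translationNumber_pow, hτ]; push_cast at h ⊢; linarith
    have := (H.deg1Lift ^ d).lt_map_of_int_lt_translationNumber hd (H.lift^[a] x)
    rw [deg1Lift_pow_apply, ← Function.iterate_add_apply] at this
    push_cast at this
    linarith
  · obtain ⟨d, rfl⟩ := Nat.exists_eq_add_of_le' hab
    have hd : (H.deg1Lift ^ d).translationNumber < ((l - k : ℤ) : ℝ) := by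
      rw [CircleDeg1Lift.translationNumber_pow, hτ]; push_cast at h ⊢; linarith
    have := (H.deg1Lift ^ d).map_lt_of_translationNumber_lt_int hd (H.lift^[b] x)
    rw [deg1Lift_pow_apply, ← Function.iterate_add_apply] at this
    push_cast at this
    linarith

end CircleHomeo

lemma Irrational.natCast_mul_add_intCast_inj {β : ℝ} (hβ : Irrational β) {a b : ℕ} {k l : ℤ}
    (h : a * β + k = b * β + l) : a = b := by
  by_contra hab
  have hne : ((a : ℤ) - b) ≠ 0 := sub_ne_zero.2 (mod_cast hab)
  apply (hβ.intCast_mul hne).ne_int (l - k)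
  push_cast
  linarith

namespace CircleHomeo

variable {H : CircleHomeo} {β : ℝ}

lemma lift_iterate_le (hβ : Irrational β) (hτ : H.deg1Lift.translationNumber = β) (x : ℝ)
    {a b : ℕ} {k l : ℤ} (h : a * β + k ≤ b * β + l) : H.lift^[a] x + k ≤ H.lift^[b] x + l := by
  rcases h.lt_or_eq with h | h
  · exact (lift_iterate_lt hτ x h).le
  · obtain rfl := hβ.natCast_mul_add_intCast_inj h
    linarith

lemma natCast_mul_add_le_of_lift_iterate_le (hτ : H.deg1Lift.translationNumber = β) {x : ℝ}
    {a b : ℕ} {k l : ℤ} (h : H.lift^[a] x + k ≤ H.lift^[b] x + l) : a * β + k ≤ b * β + l := by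
  by_contra! h'
  exact (lift_iterate_lt hτ x h').not_ge h

lemma eq_of_projC_lift_iterate_eq (hβ : Irrational β) (hτ : H.deg1Lift.translationNumber = β)
    {x : ℝ} {a b : ℕ} (h : projC (H.lift^[a] x) = projC (H.lift^[b] x)) : a = b := by
  obtain ⟨k, hk⟩ := projC_eq_iff.1 h
  have h1 := natCast_mul_add_le_of_lift_iterate_le (a := a) (b := b) (k := 0) (l := k) hτ
    (by simpa using hk.le)
  have h2 := natCast_mul_add_le_of_lift_iterate_le (a := b) (b := a) (k := k) (l := 0) hτ
    (by simpa using hk.ge)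
  exact hβ.natCast_mul_add_intCast_inj (le_antisymm h1 h2)

end CircleHomeo

namespace DynPart

open CircleHomeo

variable {H : CircleHomeo} {α : ℝ}

lemma irrational_translationNumber (hα : Irrational α)
    (hfr : Int.fract H.deg1Lift.translationNumber = α) :
    Irrational H.deg1Lift.translationNumber := by
  rw [← Int.fract_add_floor H.deg1Lift.translationNumber, hfr]
  exact hα.add_intCast _

lemma mem_Ico_of_fract_eq {β : ℝ} (hfr : Int.fract β = α) : α ∈ Ico (0 : ℝ) 1 :=
  hfr ▸ ⟨Int.fract_nonneg _, Int.fract_lt_one _⟩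

lemma abs_cfErr_le_of_fract_eq (hα : Irrational α) {β : ℝ} (hfr : Int.fract β = α) (n : ℕ)
    {m : ℕ} (hm : 0 < m) (hmq : m < cfQ α (n + 1)) (k : ℤ) : |cfErr α n| ≤ |m * β - k| := by
  have h := abs_cfErr_le hα (mem_Ico_of_fract_eq hfr) n hm hmq (k - m * ⌊β⌋)
  have hβ : α = β - ⌊β⌋ := hfr.symm
  convert h using 2
  rw [hβ]
  push_cast
  ring

/-- For every `i`, the arc `I_n^i` lifts to the interval from the translate by `k` of the
`(i + u)`-th orbit point to the translate by `l` of the `(i + v)`-th one. -/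
structure IsArcData (H : CircleHomeo) (α : ℝ) (n u v : ℕ) (k l : ℤ) : Prop where
  length_eq : v * H.deg1Lift.translationNumber + l - (u * H.deg1Lift.translationNumber + k)
    = |cfErr α n|
  endpoint : u = 0 ∧ k = 0 ∨ v = 0 ∧ l = 0
  Ini_eq : ∀ x i, Ini H α (projC x) n i = projC '' Ico (H.lift^[i + u] x + k)
    (H.lift^[i + v] x + l)
  Ini_eq_arcIco : ∀ x i, Ini H α (projC x) n i
    = arcIco (projC (H.lift^[i + u] x + k)) (projC (H.lift^[i + v] x + l))

lemma exists_isArcData (hα : Irrational α)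
    (hfr : Int.fract H.deg1Lift.translationNumber = α) (n : ℕ) :
    ∃ u v k l, IsArcData H α n u v k l := by
  have h01 := mem_Ico_of_fract_eq hfr
  have hβ := irrational_translationNumber hα hfr
  obtain ⟨p, hp⟩ : ∃ p : ℤ, cfErr α n = cfQ α n * H.deg1Lift.translationNumber - p := by
    refine ⟨cfP α n + cfQ α n * ⌊H.deg1Lift.translationNumber⌋, ?_⟩
    rw [cfErr, ← hfr, Int.fract]
    push_cast
    ring
  have hlt := abs_cfErr_lt_one hα h01 n
  have habs := abs_cfErr hα h01 n
  obtain ⟨u, v, k, l, hlen, hend, hIn⟩ : ∃ (u v : ℕ) (k l : ℤ),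
      v * H.deg1Lift.translationNumber + l - (u * H.deg1Lift.translationNumber + k)
        = |cfErr α n| ∧ (u = 0 ∧ k = 0 ∨ v = 0 ∧ l = 0) ∧
      ∀ x, In H α (projC x) n = arcIco (projC (H.lift^[u] x + k)) (projC (H.lift^[v] x + l)) := by
    rcases n.even_or_odd with hn | hn
    · refine ⟨0, cfQ α n, 0, -p, ?_, .inl ⟨rfl, rfl⟩, fun x => ?_⟩
      · rw [habs, hn.neg_one_pow, hp]; push_cast; ring
      · simp only [In, if_pos hn, pt, toFun_iterate_projC, projC_add_intCast]
        rfl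
    · refine ⟨cfQ α n, 0, -p, 0, ?_, .inr ⟨rfl, rfl⟩, fun x => ?_⟩
      · rw [habs, hn.neg_one_pow, hp]; push_cast; ring
      · simp only [In, if_neg (Nat.not_even_iff_odd.2 hn), pt, toFun_iterate_projC,
          projC_add_intCast]
        rfl
  have harc : ∀ x i, arcIco (projC (H.lift^[i + u] x + k)) (projC (H.lift^[i + v] x + l))
      = projC '' Ico (H.lift^[i + u] x + k) (H.lift^[i + v] x + l) := fun x i => by
    refine arcIco_projC (lift_iterate_le hβ rfl x ?_) ?_
    · push_cast; linarith [abs_nonneg (cfErr α n)]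
    · have := lift_iterate_lt rfl x (a := i + v) (b := i + u) (k := l) (l := k + 1)
        (by push_cast; linarith)
      push_cast at this
      linarith
  have hIni : ∀ x i, Ini H α (projC x) n i = projC '' Ico (H.lift^[i + u] x + k)
      (H.lift^[i + v] x + l) := fun x i => by
    have h0 := harc x 0
    simp only [zero_add] at h0
    rw [Ini, hIn, h0, toFun_iterate_image_projC_Ico, lift_iterate_add_intCast,
      lift_iterate_add_intCast, ← Function.iterate_add_apply, ← Function.iterate_add_apply]
    exact lift_iterate_le hβ rfl x (by linarith [abs_nonneg (cfErr α n)])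
  exact ⟨u, v, k, l, hlen, hend, hIni, fun x i => by rw [hIni, harc]⟩

lemma disjoint_Ini (hα : Irrational α) (hfr : Int.fract H.deg1Lift.translationNumber = α)
    (x : ℝ) (n : ℕ) {i j : ℕ} (hi : i < cfQ α (n + 1)) (hj : j < cfQ α (n + 1)) (hij : i ≠ j) :
    Disjoint (Ini H α (projC x) n i) (Ini H α (projC x) n j) := by
  wlog hlt : i < j generalizing i j
  · exact (this hj hi hij.symm (lt_of_le_of_ne (not_lt.1 hlt) hij.symm)).symm
  obtain ⟨u, v, k, l, hJ⟩ := exists_isArcData hα hfr n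
  have hβ := irrational_translationNumber hα hfr
  rw [Set.disjoint_left, hJ.Ini_eq, hJ.Ini_eq]
  rintro _ ⟨y, hy, rfl⟩ ⟨z, hz, hzy⟩
  obtain ⟨t, rfl⟩ := projC_eq_iff.1 hzy
  have h1 : ((i + u : ℕ) : ℝ) * H.deg1Lift.translationNumber + (k + t : ℤ)
      < (j + v : ℕ) * H.deg1Lift.translationNumber + l := by
    by_contra! h
    have := lift_iterate_le hβ rfl x h
    push_cast at this
    linarith [hy.1, hz.2]
  have h2 : ((j + u : ℕ) : ℝ) * H.deg1Lift.translationNumber + (k - t : ℤ)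
      < (i + v : ℕ) * H.deg1Lift.translationNumber + l := by
    by_contra! h
    have := lift_iterate_le hβ rfl x h
    push_cast at this
    linarith [hy.2, hz.1]
  have h3 := abs_cfErr_le_of_fract_eq hα hfr n (Nat.sub_pos_of_lt hlt) (by omega) t
  refine h3.not_gt (abs_lt.2 ?_)
  have hlen := hJ.length_eq
  push_cast [Nat.cast_sub hlt.le] at h1 h2 ⊢
  constructor <;> linarith

lemma measurableSet_Ini (hα : Irrational α)
    (hfr : Int.fract H.deg1Lift.translationNumber = α) (x : ℝ) (n i : ℕ) :
    MeasurableSet (Ini H α (projC x) n i) := by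
  obtain ⟨u, v, k, l, hJ⟩ := exists_isArcData hα hfr n
  rw [hJ.Ini_eq_arcIco]
  exact measurableSet_arcIco _ _

lemma sum_measureReal_Ini_le_one (hα : Irrational α)
    (hfr : Int.fract H.deg1Lift.translationNumber = α) (x : ℝ) (n : ℕ) :
    ∑ i ∈ Finset.range (cfQ α (n + 1)),
      (volume : Measure Circle1).real (Ini H α (projC x) n i) ≤ 1 := by
  rw [← measureReal_biUnion_finset]
  · refine (measureReal_mono (subset_univ _)).trans_eq ?_
    simp [measureReal_def, AddCircle.measure_univ]
  · intro i hi j hj hij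
    exact disjoint_Ini hα hfr x n (by simpa using hi) (by simpa using hj) hij
  · exact fun i _ => measurableSet_Ini hα hfr x n i

/-- A point lies in at most two of the closed arcs spanned by the `I_n^m`, `m < q_{n+1}`. -/
lemma IsArcData.card_le_two (hα : Irrational α)
    (hfr : Int.fract H.deg1Lift.translationNumber = α) {n u v : ℕ} {k l : ℤ}
    (hJ : IsArcData H α n u v k l) (x : ℝ) (w : Circle1) {S : Finset ℕ}
    (hS : ∀ m ∈ S, m < cfQ α (n + 1) ∧
      w ∈ projC '' Icc (H.lift^[m + u] x + k) (H.lift^[m + v] x + l)) : S.card ≤ 2 := by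
  classical
  have hβ := irrational_translationNumber hα hfr
  have hright : ∀ m ∈ S, w ∉ Ini H α (projC x) n m → w = projC (H.lift^[m + v] x) := by
    intro m hm hw
    obtain ⟨y, hy, rfl⟩ := (hS m hm).2
    rcases hy.2.lt_or_eq with h | h
    · exact absurd (hJ.Ini_eq x m ▸ mem_image_of_mem _ ⟨hy.1, h⟩) hw
    · rw [h, projC_add_intCast]
  have hinj : Set.InjOn (fun m => decide (w ∈ Ini H α (projC x) n m)) (S : Set ℕ) := by
    intro a ha b hb hab
    simp only [decide_eq_decide] at hab
    by_cases hwa : w ∈ Ini H α (projC x) n a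
    · by_contra hne
      exact Set.disjoint_left.1 (disjoint_Ini hα hfr x n (hS a ha).1 (hS b hb).1 hne) hwa
        (hab.1 hwa)
    · have h := (hright a ha hwa).symm.trans (hright b hb (fun h => hwa (hab.2 h)))
      exact Nat.add_right_cancel (eq_of_projC_lift_iterate_eq hβ rfl h)
  exact (Finset.card_le_card_of_injOn (t := Finset.univ) _ (fun _ _ => Finset.mem_univ _)
    hinj).trans_eq (by simp)

/-- The base point lies in none of the closed arcs spanned by the `I_n^m`, `0 < m < q_{n+1}`. -/
lemma IsArcData.projC_notMem (hα : Irrational α)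
    (hfr : Int.fract H.deg1Lift.translationNumber = α) {n u v : ℕ} {k l : ℤ}
    (hJ : IsArcData H α n u v k l) (x : ℝ) {m : ℕ} (hm : 0 < m) (hmq : m < cfQ α (n + 1)) :
    projC x ∉ projC '' Icc (H.lift^[m + u] x + k) (H.lift^[m + v] x + l) := by
  have hβ := irrational_translationNumber hα hfr
  rintro ⟨y, hy, hyx⟩
  obtain ⟨t, rfl⟩ := projC_eq_iff.1 hyx
  have h1 := natCast_mul_add_le_of_lift_iterate_le (a := m + u) (b := 0) (l := t) rfl hy.1
  have h2 := natCast_mul_add_le_of_lift_iterate_le (a := 0) (b := m + v) (k := t) rfl hy.2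
  have h3 := abs_cfErr_le_of_fract_eq hα hfr n hm hmq
  have hlen := hJ.length_eq
  rcases hJ.endpoint with ⟨rfl, rfl⟩ | ⟨rfl, rfl⟩
  · have h4 : |m * H.deg1Lift.translationNumber - t| = t - m * H.deg1Lift.translationNumber := by
      rw [abs_of_nonpos] <;> push_cast at h1 <;> linarith
    have := h3 t
    have h5 := hβ.natCast_mul_add_intCast_inj (a := 0) (b := m + v) (k := t) (l := l)
      (le_antisymm h2 (by push_cast at hlen ⊢; linarith))
    omega
  · have h4 : |m * H.deg1Lift.translationNumber - t| = m * H.deg1Lift.translationNumber - t := by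
      rw [abs_of_nonneg]; push_cast at h2; linarith
    have := h3 t
    have h5 := hβ.natCast_mul_add_intCast_inj (a := m + u) (b := 0) (k := k) (l := t)
      (le_antisymm h1 (by push_cast at hlen ⊢; linarith))
    omega

end DynPart

lemma exists_deriv_iterate_eq_zero {F : ℝ → ℝ} (hF : Differentiable ℝ F) {m : ℕ} {x : ℝ}
    (h : deriv (F^[m]) x = 0) : ∃ i < m, deriv F (F^[i] x) = 0 := by
  induction m generalizing x with
  | zero => simp at h
  | succ m ih =>
    rw [Function.iterate_succ, deriv_comp x ((hF.iterate m) _) (hF x), mul_eq_zero] at h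
    rcases h with h | h
    · obtain ⟨i, hi, hx⟩ := ih h
      exact ⟨i + 1, by omega, hx⟩
    · exact ⟨0, by omega, h⟩

section CriticalTimes

open DynPart CircleHomeo

variable {f : MulticriticalCircleMap} {α : ℝ}

/-- A critical time `j` is witnessed by a critical point of `f`, other than the base point, in
the closed arc spanned by some `Δ_{i,j}`. -/
lemma exists_crit_of_mem_critTimesSet (hα : Irrational α)
    (hfr : Int.fract f.toCircleHomeo.deg1Lift.translationNumber = α) (i0 : Fin f.N) {n u v : ℕ}
    {k l : ℤ} (hJ : IsArcData f.toCircleHomeo α (n + 1) u v k l) {j : ℕ}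
    (hj : j ∈ critTimesSet f α (projC (f.crit i0)) (n + 1)) :
    ∃ i < cfQ α (n + 1), ∃ r ≠ i0, projC (f.crit r) ∈ projC ''
      Icc (f.lift^[i + cfQ α n + j * cfQ α (n + 1) + u] (f.crit i0) + k)
        (f.lift^[i + cfQ α n + j * cfQ α (n + 1) + v] (f.crit i0) + l) := by
  simp only [critTimesSet, Finset.mem_filter, Finset.mem_Ioo] at hj
  obtain ⟨⟨hj0, hja⟩, z, hz, x, rfl, hx⟩ := hj
  obtain ⟨i, hi, hxi⟩ := exists_deriv_iterate_eq_zero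
    (f.smooth.differentiable (by norm_num)) hx
  obtain ⟨r, t, hr⟩ := f.crit_complete _ hxi
  rw [Δ, hJ.Ini_eq] at hz
  obtain ⟨y, hy, hyx⟩ := closure_projC_image_Ico_subset _ _ hz
  have hmono := (f.lift_strictMono.iterate i).monotone
  have hmem : projC (f.crit r) ∈ projC ''
      Icc (f.lift^[i + cfQ α n + j * cfQ α (n + 1) + u] (f.crit i0) + k)
        (f.lift^[i + cfQ α n + j * cfQ α (n + 1) + v] (f.crit i0) + l) := by
    refine ⟨f.lift^[i] y, ⟨?_, ?_⟩, ?_⟩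
    · convert hmono hy.1 using 1
      rw [lift_iterate_add_intCast, ← Function.iterate_add_apply]
      simp only [Nat.add_sub_cancel, zero_add, ← add_assoc]
    · convert hmono hy.2 using 1
      rw [lift_iterate_add_intCast, ← Function.iterate_add_apply]
      simp only [Nat.add_sub_cancel, zero_add, ← add_assoc]
    · rw [← toFun_iterate_projC, hyx, toFun_iterate_projC, hr, projC_add_intCast]
  refine ⟨i, hi, r, ?_, hmem⟩
  rintro rfl
  refine hJ.projC_notMem hα hfr (f.crit r) ?_ ?_ hmem
  · have := Nat.mul_pos hj0 (cfQ_pos hα (mem_Ico_of_fract_eq hfr) (n + 1)); omega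
  · have : (j + 1) * cfQ α (n + 1) ≤ cfA α (n + 2) * cfQ α (n + 1) :=
      Nat.mul_le_mul_right _ (by change j < cfA α (n + 2) - 1 at hja; omega)
    rw [cfQ_add_two]
    linarith

/-- The base point is critical but does not contribute critical times, and every other critical
point contributes at most two. -/
lemma card_critTimesSet_le (hα : Irrational α)
    (hfr : Int.fract f.toCircleHomeo.deg1Lift.translationNumber = α) (i0 : Fin f.N) (n : ℕ) :
    (critTimesSet f α (projC (f.crit i0)) (n + 1)).card ≤ 2 * (f.N - 1) := by
  classical
  obtain ⟨u, v, k, l, hJ⟩ := exists_isArcData (H := f.toCircleHomeo) hα hfr (n + 1)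
  have : Nonempty (Fin f.N) := ⟨i0⟩
  choose! i hi r hr hmem using fun j hj =>
    exists_crit_of_mem_critTimesSet (f := f) hα hfr i0 hJ (j := j) hj
  have hcard : (Finset.univ.erase i0).card = f.N - 1 := by simp
  rw [← hcard]
  refine Finset.card_le_mul_card_image_of_maps_to (f := r)
    (fun j hj => Finset.mem_erase.2 ⟨hr j hj, Finset.mem_univ _⟩) 2 fun b _ => ?_
  set S := {j ∈ critTimesSet f α (projC (f.crit i0)) (n + 1) | r j = b}
  have hinj : Set.InjOn (fun j => i j + cfQ α n + j * cfQ α (n + 1)) (S : Set ℕ) := by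
    intro a ha c hc hac
    have hia := hi a (Finset.mem_filter.1 ha).1
    have hic := hi c (Finset.mem_filter.1 hc).1
    have h : i a + cfQ α (n + 1) * a = i c + cfQ α (n + 1) * c := by
      simp only at hac; linarith
    have hq := cfQ_pos hα (mem_Ico_of_fract_eq hfr) (n + 1)
    have := congrArg (· / cfQ α (n + 1)) h
    simpa [Nat.add_mul_div_left _ _ hq, Nat.div_eq_of_lt hia, Nat.div_eq_of_lt hic] using this
  rw [← Finset.card_image_of_injOn hinj]
  refine hJ.card_le_two hα hfr (f.crit i0) (projC (f.crit b)) fun m hm => ?_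
  obtain ⟨j, hjS, rfl⟩ := Finset.mem_image.1 hm
  obtain ⟨hj, hrj⟩ := Finset.mem_filter.1 hjS
  refine ⟨?_, hrj ▸ hmem j hj⟩
  have hja : j < cfA α (n + 2) - 1 := (Finset.mem_Ioo.1 (Finset.mem_filter.1 hj).1).2
  have : (j + 1) * cfQ α (n + 1) ≤ cfA α (n + 2) * cfQ α (n + 1) :=
    Nat.mul_le_mul_right _ (by omega)
  have := hi j hj
  rw [cfQ_add_two]
  linarith

lemma rn_le (hα : Irrational α)
    (hfr : Int.fract f.toCircleHomeo.deg1Lift.translationNumber = α) (i0 : Fin f.N) (n : ℕ) :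
    rn f α (projC (f.crit i0)) (n + 1) ≤ 2 * f.N := by
  have := card_critTimesSet_le hα hfr i0 n
  have := f.N_pos
  rw [rn]
  omega

end CriticalTimes

section Trimmed

lemma sum_inv_sq_le_of_forall_lt {S : Finset ℕ} {L : ℕ} (hL : L ≠ 0) (hS : ∀ u ∈ S, L < u) :
    ∑ u ∈ S, ((u : ℝ) ^ 2)⁻¹ ≤ (L : ℝ)⁻¹ := by
  have hsub : S ⊆ Finset.Ioc L (max L (S.sup id)) := fun u hu =>
    Finset.mem_Ioc.2 ⟨hS u hu, (Finset.le_sup (f := id) hu).trans (le_max_right _ _)⟩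
  calc ∑ u ∈ S, ((u : ℝ) ^ 2)⁻¹
      ≤ ∑ u ∈ Finset.Ioc L (max L (S.sup id)), ((u : ℝ) ^ 2)⁻¹ :=
        Finset.sum_le_sum_of_subset_of_nonneg hsub fun _ _ _ => by positivity
    _ ≤ (L : ℝ)⁻¹ - ((max L (S.sup id) : ℕ) : ℝ)⁻¹ := sum_Ioc_inv_sq_le_sub hL (le_max_left _ _)
    _ ≤ (L : ℝ)⁻¹ := sub_le_self _ (by positivity)

lemma sum_inv_sq_le_of_forall_le {S : Finset ℕ} {L : ℕ} (hL : L ≠ 0) (hS : ∀ u ∈ S, L ≤ u) :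
    ∑ u ∈ S, ((u : ℝ) ^ 2)⁻¹ ≤ (L : ℝ)⁻¹ + ((L : ℝ) ^ 2)⁻¹ := by
  calc ∑ u ∈ S, ((u : ℝ) ^ 2)⁻¹
      ≤ ∑ u ∈ insert L (S.erase L), ((u : ℝ) ^ 2)⁻¹ :=
        Finset.sum_le_sum_of_subset_of_nonneg (Finset.insert_erase_subset L S)
          fun _ _ _ => by positivity
    _ = ((L : ℝ) ^ 2)⁻¹ + ∑ u ∈ S.erase L, ((u : ℝ) ^ 2)⁻¹ :=
        Finset.sum_insert (Finset.notMem_erase L S)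
    _ ≤ ((L : ℝ) ^ 2)⁻¹ + (L : ℝ)⁻¹ := by
        gcongr
        refine sum_inv_sq_le_of_forall_lt hL fun u hu => ?_
        have := Finset.mem_erase.1 hu
        exact lt_of_le_of_ne (hS u this.2) this.1.symm
    _ = _ := add_comm _ _

lemma sum_inv_min_sq_le {J : Finset ℕ} {L a b : ℕ} (hL : L ≠ 0)
    (hJ : ∀ j ∈ J, a + L < j ∧ j + L ≤ b) :
    ∑ j ∈ J, (((min (j - a) (b - j) : ℕ) : ℝ) ^ 2)⁻¹
      ≤ 2 * (L : ℝ)⁻¹ + ((L : ℝ) ^ 2)⁻¹ := by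
  have hle : ∀ j ∈ J, (((min (j - a) (b - j) : ℕ) : ℝ) ^ 2)⁻¹
      ≤ (((j - a : ℕ) : ℝ) ^ 2)⁻¹ + (((b - j : ℕ) : ℝ) ^ 2)⁻¹ := by
    intro j _
    rcases min_choice (j - a) (b - j) with h | h <;> rw [h]
    · exact le_add_of_nonneg_right (by positivity)
    · exact le_add_of_nonneg_left (by positivity)
  have h1 : ∑ j ∈ J, (((j - a : ℕ) : ℝ) ^ 2)⁻¹ ≤ (L : ℝ)⁻¹ := by
    rw [← Finset.sum_image (s := J) (g := fun j => j - a) (f := fun u : ℕ => ((u : ℝ) ^ 2)⁻¹)]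
    · refine sum_inv_sq_le_of_forall_lt hL fun u hu => ?_
      obtain ⟨j, hj, rfl⟩ := Finset.mem_image.1 hu
      have := hJ j hj
      omega
    · intro i hi j hj hij
      have := hJ i hi
      have := hJ j hj
      simp only at hij
      omega
  have h2 : ∑ j ∈ J, (((b - j : ℕ) : ℝ) ^ 2)⁻¹ ≤ (L : ℝ)⁻¹ + ((L : ℝ) ^ 2)⁻¹ := by
    rw [← Finset.sum_image (s := J) (g := fun j => b - j) (f := fun u : ℕ => ((u : ℝ) ^ 2)⁻¹)]
    · refine sum_inv_sq_le_of_forall_le hL fun u hu => ?_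
      obtain ⟨j, hj, rfl⟩ := Finset.mem_image.1 hu
      have := hJ j hj
      omega
    · intro i hi j hj hij
      have := hJ i hi
      have := hJ j hj
      simp only at hij
      omega
  calc _ ≤ _ := Finset.sum_le_sum hle
    _ = _ := Finset.sum_add_distrib
    _ ≤ (L : ℝ)⁻¹ + ((L : ℝ)⁻¹ + ((L : ℝ) ^ 2)⁻¹) := add_le_add h1 h2
    _ = _ := by ring

variable {f : MulticriticalCircleMap} {α γ : ℝ} {x0 : Circle1} {n : ℕ}

lemma add_floor_lt_and_le {a k k' j : ℕ}
    (h : (k : ℝ) + (a : ℝ) ^ γ < j ∧ (j : ℝ) < k' + 1 - (a : ℝ) ^ γ) :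
    k + ⌊(a : ℝ) ^ γ⌋₊ < j ∧ j + ⌊(a : ℝ) ^ γ⌋₊ ≤ k' := by
  have hfl : (⌊(a : ℝ) ^ γ⌋₊ : ℝ) ≤ (a : ℝ) ^ γ := Nat.floor_le (by positivity)
  refine ⟨by exact_mod_cast (by linarith [h.1] : (k : ℝ) + ⌊(a : ℝ) ^ γ⌋₊ < j), ?_⟩
  have : (j : ℝ) + ⌊(a : ℝ) ^ γ⌋₊ < k' + 1 := by linarith [h.2]
  exact Nat.lt_succ_iff.1 (by exact_mod_cast this)

lemma image_bridgeGamma_subset (i s : ℕ) :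
    f.toCircleHomeo.toFun^[i] '' bridgeGamma f α x0 n γ s ⊆
      ⋃ j ∈ Finset.Ioc (kTime f α x0 n s + ⌊(cfA α (n + 1) : ℝ) ^ γ⌋₊)
        (kTime f α x0 n (s + 1) - ⌊(cfA α (n + 1) : ℝ) ^ γ⌋₊),
        DynPart.Δ f.toCircleHomeo α x0 n i j := by
  rintro _ ⟨z, hz, rfl⟩
  simp only [bridgeGamma, mem_iUnion] at hz
  obtain ⟨j, hj, hz⟩ := hz
  have := add_floor_lt_and_le hj
  simp only [mem_iUnion]
  refine ⟨j, Finset.mem_Ioc.2 ⟨this.1, by omega⟩, ?_⟩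
  obtain ⟨y, hy, rfl⟩ := hz
  refine ⟨y, hy, ?_⟩
  rw [← Function.iterate_add_apply]
  simp only [zero_add, ← add_assoc]

end Trimmed

/-- If the atoms within the bridges satisfy the Yoccoz-type estimate
`M⁻¹|I_{n-1}^i|/min{j-k_s, k_{s+1}-j}² < |Δ^{(n)}_{i,j}| < M|I_{n-1}^i|/min{j-k_s, k_{s+1}-j}²`,
then `|A^n_γ| ≤ (4N+2) M / ⌊a_{n+1}^γ⌋`. -/
theorem stmt7 (f : MulticriticalCircleMap) (α : ℝ) (hirr : Irrational α)
    (hrot : HasRotationNumber f.toCircleHomeo α) (i0 : Fin f.N)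
    (M : ℝ) (hM : 1 < M) (n : ℕ) (hn : 1 ≤ n)
    (hYoc : ∀ i < cfQ α n, ∀ s < rn f α (projC (f.crit i0)) n,
      ∀ j, kTime f α (projC (f.crit i0)) n s < j → j < kTime f α (projC (f.crit i0)) n (s + 1) →
        M⁻¹ * (volume (DynPart.Ini f.toCircleHomeo α (projC (f.crit i0)) (n - 1) i)).toReal
            / ((min (j - kTime f α (projC (f.crit i0)) n s)
                (kTime f α (projC (f.crit i0)) n (s + 1) - j) : ℕ) : ℝ) ^ 2
          < (volume (DynPart.Δ f.toCircleHomeo α (projC (f.crit i0)) n i j)).toReal ∧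
        (volume (DynPart.Δ f.toCircleHomeo α (projC (f.crit i0)) n i j)).toReal
          < M * (volume (DynPart.Ini f.toCircleHomeo α (projC (f.crit i0)) (n - 1) i)).toReal
            / ((min (j - kTime f α (projC (f.crit i0)) n s)
                (kTime f α (projC (f.crit i0)) n (s + 1) - j) : ℕ) : ℝ) ^ 2)
    (γ : ℝ) (hγ : γ ∈ Set.Ioo (0 : ℝ) 1) :
    (volume (AsetAll f α (projC (f.crit i0)) n γ)).toReal
      ≤ (4 * f.N + 2) * M / (⌊(cfA α (n + 1) : ℝ) ^ γ⌋₊ : ℝ) := by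
  obtain ⟨n, rfl⟩ := Nat.exists_eq_add_of_le' hn
  obtain ⟨h01, β, hβα, hβ⟩ := hrot
  have hfr : Int.fract f.toCircleHomeo.deg1Lift.translationNumber = α := by
    rw [CircleHomeo.translationNumber_deg1Lift hβ, hβα]
  set x0 := projC (f.crit i0)
  set L := ⌊(cfA α (n + 1 + 1) : ℝ) ^ γ⌋₊
  have hL : 1 ≤ L := by
    refine (Nat.one_le_floor_iff _).2 (Real.one_le_rpow ?_ hγ.1.le)
    exact_mod_cast one_le_cfA_succ hirr h01 (n + 1)
  have hL0 : (1 : ℝ) ≤ L := mod_cast hL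
  have hLpos : (0 : ℝ) < L := by linarith
  have hr : (rn f α x0 (n + 1) : ℝ) ≤ 2 * f.N := mod_cast rn_le hirr hfr i0 n
  have hN : (1 : ℝ) ≤ f.N := mod_cast f.N_pos
  rcases lt_or_ge (L : ℝ) f.N with hLN | hLN
  · have h1 : (volume (AsetAll f α x0 (n + 1) γ)).toReal ≤ 1 := by
      refine (measureReal_mono (μ := (volume : Measure Circle1)) (subset_univ _)).trans_eq ?_
      simp [measureReal_def, AddCircle.measure_univ]
    refine h1.trans ((one_le_div hLpos).2 ?_)
    nlinarith
  have hM0 : 0 ≤ M := by linarith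
  set c : ℝ := 2 * (L : ℝ)⁻¹ + ((L : ℝ) ^ 2)⁻¹ with hc
  have hc0 : 0 ≤ c := by positivity
  have hbridge : ∀ i < cfQ α (n + 1), ∀ s < rn f α x0 (n + 1),
      (volume : Measure Circle1).real
        (f.toCircleHomeo.toFun^[i] '' bridgeGamma f α x0 (n + 1) γ s)
      ≤ c * (M * (volume : Measure Circle1).real (DynPart.Ini f.toCircleHomeo α x0 n i)) := by
    intro i hi s hs
    refine (measureReal_mono (image_bridgeGamma_subset i s) (measure_ne_top _ _)).trans
      ((measureReal_biUnion_finset_le _ _).trans ?_)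
    set J := Finset.Ioc (kTime f α x0 (n + 1) s + L) (kTime f α x0 (n + 1) (s + 1) - L)
    have hJ : ∀ j ∈ J, kTime f α x0 (n + 1) s + L < j ∧ j + L ≤ kTime f α x0 (n + 1) (s + 1) := by
      intro j hj
      have := Finset.mem_Ioc.1 hj
      omega
    refine le_trans (Finset.sum_le_sum fun j hj => ?_) (le_trans (Finset.sum_mul _ _ _).ge
      (mul_le_mul_of_nonneg_right (sum_inv_min_sq_le (by omega) hJ) (by positivity)))
    have := hJ j hj
    have := (hYoc i hi s hs j (by omega) (by omega)).2.le
    rw [div_eq_inv_mul] at this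
    exact this
  have hA : ∀ i < cfQ α (n + 1), (volume : Measure Circle1).real (Aset f α x0 (n + 1) i γ)
      ≤ 2 * f.N * c * M
        * (volume : Measure Circle1).real (DynPart.Ini f.toCircleHomeo α x0 n i) := by
    intro i hi
    have hset : Aset f α x0 (n + 1) i γ = ⋃ s ∈ Finset.range (rn f α x0 (n + 1)),
        f.toCircleHomeo.toFun^[i] '' bridgeGamma f α x0 (n + 1) γ s := by
      simp [Aset]
    rw [hset]
    refine (measureReal_biUnion_finset_le _ _).trans ((Finset.sum_le_sum fun s hs =>
      hbridge i hi s (Finset.mem_range.1 hs)).trans ?_)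
    rw [Finset.sum_const, Finset.card_range, nsmul_eq_mul,
      show ∀ x : ℝ, 2 * f.N * c * M * x = 2 * f.N * (c * (M * x)) from fun x => by ring]
    exact mul_le_mul_of_nonneg_right hr (by positivity)
  have hset : AsetAll f α x0 (n + 1) γ = ⋃ i ∈ Finset.range (cfQ α (n + 1)),
      Aset f α x0 (n + 1) i γ := by
    simp [AsetAll]
  have hsum := DynPart.sum_measureReal_Ini_le_one (H := f.toCircleHomeo) hirr hfr (f.crit i0) n
  calc (volume : Measure Circle1).real (AsetAll f α x0 (n + 1) γ)
      ≤ ∑ i ∈ Finset.range (cfQ α (n + 1)), 2 * f.N * c * M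
        * (volume : Measure Circle1).real (DynPart.Ini f.toCircleHomeo α x0 n i) := by
        rw [hset]
        exact (measureReal_biUnion_finset_le _ _).trans
          (Finset.sum_le_sum fun i hi => hA i (Finset.mem_range.1 hi))
    _ ≤ 2 * f.N * c * M := by
        rw [← Finset.mul_sum]
        exact mul_le_of_le_one_right (by positivity) hsum
    _ ≤ (4 * f.N + 2) * M / L := by
        have : 2 * f.N * c ≤ (4 * f.N + 2) / L := by
          rw [hc, le_div_iff₀ hLpos]
          have h : 2 * f.N * (2 * (L : ℝ)⁻¹ + ((L : ℝ) ^ 2)⁻¹) * L = 4 * f.N + 2 * (f.N / L) := by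
            field_simp
            ring
          rw [h]
          linarith [(div_le_one hLpos).2 hLN]
        calc 2 * f.N * c * M ≤ (4 * f.N + 2) / L * M := mul_le_mul_of_nonneg_right this hM0
          _ = _ := by ring
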